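/- Let D ⊆ ℝⁿ be open, let E ⊆ D be closed in D and satisfy assumption (E), and let ℓ be a local action on D. Let x ∈ E be such that ℓ(x,y) > 0 for every y ∈ ℝⁿ with y ≠ 0. Then x has strong local minimizers. -/

import Mathlib

open MeasureTheory Set Filter
open scoped RealInnerProductSpace

abbrev Euc (n : ℕ) := EuclideanSpace ℝ (Fin n)

/-- `φ` is absolutely continuous on `[0,1]` with derivative `φ'`. -/
def GeoAC {n : ℕ} (φ φ' : ℝ → Euc n) : Prop :=
  MeasureTheory.IntegrableOn φ' (Set.Icc 0 1) ∧
    ∀ t ∈ Set.Icc (0:ℝ) 1, φ t = φ 0 + ∫ s in (0:ℝ)..t, φ' s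

/-- The geometric action `S(φ) = ∫₀¹ ℓ(φ,φ') dα`. -/
noncomputable def geoAction {n : ℕ} (ℓ : Euc n → Euc n → ℝ) (φ φ' : ℝ → Euc n) : ℝ :=
  ∫ α in (0:ℝ)..1, ℓ (φ α) (φ' α)

/-- The length `∫₀¹ |φ'| dα` of an absolutely continuous curve. -/
noncomputable def geoLen {n : ℕ} (φ' : ℝ → Euc n) : ℝ :=
  ∫ α in (0:ℝ)..1, ‖φ' α‖

/-- The set of actions of absolutely continuous curves in `Eset` from `A₁` to `A₂`. -/
def geoActSet {n : ℕ} (ℓ : Euc n → Euc n → ℝ) (Eset A₁ A₂ : Set (Euc n)) : Set ℝ :=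
  {s | ∃ φ φ' : ℝ → Euc n, GeoAC φ φ' ∧ (∀ t ∈ Set.Icc (0:ℝ) 1, φ t ∈ Eset) ∧
    φ 0 ∈ A₁ ∧ φ 1 ∈ A₂ ∧ s = geoAction ℓ φ φ'}

/-- Assumption (E): nearby points of `Eset` can be joined by short curves in `Eset`. -/
def GeoAssumpE {n : ℕ} (Eset : Set (Euc n)) : Prop :=
  ∀ x ∈ Eset, ∀ ν > (0:ℝ), ∃ r > (0:ℝ), ∀ w ∈ Metric.closedBall x r ∩ Eset,
    ∃ φ φ' : ℝ → Euc n, GeoAC φ φ' ∧ (∀ t ∈ Set.Icc (0:ℝ) 1, φ t ∈ Eset) ∧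
      φ 0 = x ∧ φ 1 = w ∧ geoLen φ' ≤ ν

/-- A point `x ∈ Eset` has strong local minimizers. -/
def GeoHasStrongLocalMin {n : ℕ} (ℓ : Euc n → Euc n → ℝ) (Eset : Set (Euc n))
    (x : Euc n) : Prop :=
  ∃ r > (0:ℝ), ∃ η > (0:ℝ), ∃ K : Set (Euc n), IsCompact K ∧ K ⊆ Eset ∧
    ∀ x₁ ∈ Metric.closedBall x r ∩ Eset, ∀ x₂ ∈ Metric.closedBall x r ∩ Eset,
      ∃ φ φ' : ℝ → Euc n, GeoAC φ φ' ∧ (∀ t ∈ Set.Icc (0:ℝ) 1, φ t ∈ K) ∧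
        φ 0 = x₁ ∧ φ 1 = x₂ ∧ geoLen φ' ≤ η ∧
        geoAction ℓ φ φ' = sInf (geoActSet ℓ Eset {x₁} {x₂})

/-- `ℓ` is a local action on `D`. -/
structure IsLocalAction {n : ℕ} (D : Set (Euc n)) (ℓ : Euc n → Euc n → ℝ) : Prop where
  isOpen : IsOpen D
  continuousOn : ContinuousOn (fun p : Euc n × Euc n => ℓ p.1 p.2) (D ×ˢ Set.univ)
  nonneg : ∀ x ∈ D, ∀ y : Euc n, 0 ≤ ℓ x y
  hom : ∀ x ∈ D, ∀ y : Euc n, ∀ c : ℝ, 0 ≤ c → ℓ x (c • y) = c * ℓ x y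
  convexOn : ∀ x ∈ D, ConvexOn ℝ Set.univ (fun y => ℓ x y)

section Lipschitz

variable {F : Type*} [NormedAddCommGroup F] [NormedSpace ℝ F] [FiniteDimensional ℝ F]

theorem LipschitzWith.intervalIntegrable_deriv {C : NNReal} {f : ℝ → F} (hf : LipschitzWith C f)
    (a b : ℝ) : IntervalIntegrable (deriv f) volume a b := by
  have : CompleteSpace F := FiniteDimensional.complete ℝ F
  refine (intervalIntegrable_const (c := (C : ℝ))).mono_fun
    (aestronglyMeasurable_deriv f _) (Eventually.of_forall fun t => ?_)
  simpa using norm_deriv_le_of_lipschitz hf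

/-- The fundamental theorem of calculus for vector-valued Lipschitz functions. -/
theorem LipschitzWith.integral_deriv_eq_sub {C : NNReal} {f : ℝ → F} (hf : LipschitzWith C f)
    (a b : ℝ) : ∫ t in a..b, deriv f t = f b - f a := by
  have : CompleteSpace F := FiniteDimensional.complete ℝ F
  have hint := hf.intervalIntegrable_deriv a b
  have hac : AbsolutelyContinuousOnInterval f a b :=
    (hf.lipschitzOnWith (s := uIcc a b)).absolutelyContinuousOnInterval
  have hac' : AbsolutelyContinuousOnInterval (fun x => ∫ t in a..x, deriv f t) a b := by
    refine (LipschitzOnWith.of_dist_le_mul (K := C) fun s _ t _ => ?_).absolutelyContinuousOnInterval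
    rw [dist_eq_norm, Real.dist_eq, intervalIntegral.integral_interval_sub_left
      (hf.intervalIntegrable_deriv a s) (hf.intervalIntegrable_deriv a t)]
    exact intervalIntegral.norm_integral_le_of_norm_le_const fun _ _ =>
      norm_deriv_le_of_lipschitz hf
  have hderiv : ∀ᵐ x, x ∈ uIcc a b → HasDerivAt (f - fun x => ∫ t in a..x, deriv f t) 0 x := by
    filter_upwards [hf.ae_differentiableAt_real, hint.ae_hasDerivAt_integral] with t h1 h2 ht
    have h3 := h1.hasDerivAt.sub (h2 ht a left_mem_uIcc)
    rwa [sub_self] at h3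
  obtain ⟨c, hc⟩ := (hac.sub hac').const_of_ae_hasDerivAt_zero hderiv
  have ha := hc a left_mem_uIcc
  have hb := hc b right_mem_uIcc
  simp only [Pi.sub_apply, intervalIntegral.integral_same, sub_zero] at ha hb
  rw [ha, ← hb]
  abel

end Lipschitz

section Curves

variable {n : ℕ}

theorem LipschitzWith.geoAC {C : NNReal} {f : ℝ → Euc n} (hf : LipschitzWith C f) :
    GeoAC f (deriv f) := by
  refine ⟨?_, fun t _ => ?_⟩
  · rw [integrableOn_Icc_iff_integrableOn_Ioc, ← intervalIntegrable_iff_integrableOn_Ioc_of_le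
      zero_le_one]
    exact hf.intervalIntegrable_deriv 0 1
  · rw [hf.integral_deriv_eq_sub]
    abel

theorem LipschitzWith.geoLen_deriv_le {C : NNReal} {f : ℝ → Euc n} (hf : LipschitzWith C f) :
    geoLen (deriv f) ≤ C := by
  have h := intervalIntegral.integral_mono_on (zero_le_one (α := ℝ))
    (hf.intervalIntegrable_deriv 0 1).norm (intervalIntegrable_const (c := (C : ℝ)))
    fun t _ => norm_deriv_le_of_lipschitz hf
  simpa [geoLen] using h

theorem IntegrableOn.intervalIntegrable_of_mem_Icc {F : Type*} [NormedAddCommGroup F]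
    {g : ℝ → F} {a b s t : ℝ} (hg : IntegrableOn g (Icc a b)) (hs : s ∈ Icc a b)
    (ht : t ∈ Icc a b) : IntervalIntegrable g volume s t := by
  rw [intervalIntegrable_iff]
  exact hg.mono_set (uIoc_subset_uIcc.trans (uIcc_subset_Icc hs ht))

theorem GeoAC.sub_eq_integral {φ φ' : ℝ → Euc n} (h : GeoAC φ φ') {s t : ℝ}
    (hs : s ∈ Icc (0 : ℝ) 1) (ht : t ∈ Icc (0 : ℝ) 1) : φ t - φ s = ∫ u in s..t, φ' u := by
  have h0 : (0 : ℝ) ∈ Icc (0 : ℝ) 1 := ⟨le_rfl, zero_le_one⟩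
  rw [h.2 t ht, h.2 s hs, ← intervalIntegral.integral_interval_sub_left
    (IntegrableOn.intervalIntegrable_of_mem_Icc h.1 h0 ht)
    (IntegrableOn.intervalIntegrable_of_mem_Icc h.1 h0 hs)]
  abel

theorem GeoAC.norm_sub_le {φ φ' : ℝ → Euc n} (h : GeoAC φ φ') {s t : ℝ}
    (hs : s ∈ Icc (0 : ℝ) 1) (ht : t ∈ Icc (0 : ℝ) 1) (hst : s ≤ t) :
    ‖φ t - φ s‖ ≤ ∫ u in s..t, ‖φ' u‖ := by
  rw [h.sub_eq_integral hs ht]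
  exact intervalIntegral.norm_integral_le_integral_norm hst

theorem GeoAC.continuousOn {φ φ' : ℝ → Euc n} (h : GeoAC φ φ') :
    ContinuousOn φ (Icc 0 1) := by
  refine ContinuousOn.congr (f := fun t => φ 0 + ∫ s in (0 : ℝ)..t, φ' s) ?_ fun t ht => h.2 t ht
  exact continuousOn_const.add (by
    simpa using intervalIntegral.continuousOn_primitive_interval (a := (0 : ℝ)) (b := 1)
      (by simpa using h.1))

end Curves

namespace IsLocalAction

variable {n : ℕ} {D : Set (Euc n)} {ℓ : Euc n → Euc n → ℝ}

theorem eq_norm_mul (hℓ : IsLocalAction D ℓ) {z : Euc n} (hz : z ∈ D) (y : Euc n) :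
    ℓ z y = ‖y‖ * ℓ z (‖y‖⁻¹ • y) := by
  rw [hℓ.hom z hz y _ (inv_nonneg.2 (norm_nonneg y))]
  rcases eq_or_ne y 0 with rfl | hy
  · simpa using hℓ.hom z hz 0 0 le_rfl
  · rw [mul_inv_cancel_left₀ (norm_ne_zero_iff.2 hy)]

theorem map_zero (hℓ : IsLocalAction D ℓ) {z : Euc n} (hz : z ∈ D) : ℓ z 0 = 0 := by
  simpa using hℓ.eq_norm_mul hz 0

theorem continuous_right (hℓ : IsLocalAction D ℓ) {z : Euc n} (hz : z ∈ D) :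
    Continuous (ℓ z) :=
  hℓ.continuousOn.comp_continuous (f := fun y => (z, y)) (by fun_prop) fun y => by simp [hz]

theorem mul_norm_le_of_sphere (hℓ : IsLocalAction D ℓ) {z : Euc n} (hz : z ∈ D) {c : ℝ}
    (h : ∀ y ∈ Metric.sphere (0 : Euc n) 1, c ≤ ℓ z y) (y : Euc n) : c * ‖y‖ ≤ ℓ z y := by
  rcases eq_or_ne y 0 with rfl | hy
  · simpa using hℓ.nonneg z hz 0
  · rw [hℓ.eq_norm_mul hz y, mul_comm]
    exact mul_le_mul_of_nonneg_left (h _ (by simp [norm_smul, hy])) (norm_nonneg y)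

theorem exists_le_mul_norm (hℓ : IsLocalAction D ℓ) {K : Set (Euc n)} (hK : IsCompact K)
    (hKD : K ⊆ D) : ∃ C > 0, ∀ z ∈ K, ∀ y, ℓ z y ≤ C * ‖y‖ := by
  obtain ⟨C, hC⟩ := (hK.prod (isCompact_sphere (0 : Euc n) 1)).exists_bound_of_continuousOn
    (hℓ.continuousOn.mono (prod_mono hKD (subset_univ _)))
  refine ⟨max C 1, by positivity, fun z hz y => ?_⟩
  rcases eq_or_ne y 0 with rfl | hy
  · simp [hℓ.map_zero (hKD hz)]
  · rw [hℓ.eq_norm_mul (hKD hz) y, mul_comm]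
    refine mul_le_mul_of_nonneg_right ?_ (norm_nonneg y)
    exact (le_abs_self _).trans
      ((hC (z, ‖y‖⁻¹ • y) ⟨hz, by simp [norm_smul, hy]⟩).trans (le_max_left _ _))

/-- Freezing the base point changes a local action by a small multiple of the norm. -/
theorem exists_abs_sub_le (hℓ : IsLocalAction D ℓ) {z₀ : Euc n} (hz₀ : z₀ ∈ D) {ε : ℝ}
    (hε : 0 < ε) : ∃ δ > 0, Metric.closedBall z₀ δ ⊆ D ∧
      ∀ z ∈ Metric.closedBall z₀ δ, ∀ y, |ℓ z y - ℓ z₀ y| ≤ ε * ‖y‖ := by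
  obtain ⟨v, hv, hvε⟩ := (isCompact_sphere (0 : Euc n) 1).mem_uniformity_of_prod
    (f := ℓ) (s := D) (hℓ.continuousOn.mono (prod_mono subset_rfl (subset_univ _))) hz₀
    (Metric.dist_mem_uniformity hε)
  rw [hℓ.isOpen.nhdsWithin_eq hz₀] at hv
  obtain ⟨δ, hδ, hsub⟩ := Metric.nhds_basis_closedBall.mem_iff.1
    (inter_mem hv (hℓ.isOpen.mem_nhds hz₀))
  refine ⟨δ, hδ, fun z hz => (hsub hz).2, fun z hz y => ?_⟩
  have hzD : z ∈ D := (hsub hz).2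
  rcases eq_or_ne y 0 with rfl | hy
  · simp [hℓ.map_zero hzD, hℓ.map_zero hz₀]
  · rw [hℓ.eq_norm_mul hzD y, hℓ.eq_norm_mul hz₀ y, ← mul_sub, abs_mul, abs_norm, mul_comm]
    have h := hvε z (hsub hz).1 (‖y‖⁻¹ • y) (by simp [norm_smul, hy])
    exact mul_le_mul_of_nonneg_right (le_of_lt h) (norm_nonneg y)

theorem exists_mul_norm_le (hℓ : IsLocalAction D ℓ) {x : Euc n} (hx : x ∈ D)
    (hpos : ∀ y : Euc n, y ≠ 0 → 0 < ℓ x y) :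
    ∃ R > 0, ∃ c > 0, Metric.closedBall x R ⊆ D ∧
      ∀ z ∈ Metric.closedBall x R, ∀ y, c * ‖y‖ ≤ ℓ z y := by
  obtain ⟨c, hc, hcx⟩ := (isCompact_sphere (0 : Euc n) 1).exists_forall_le'
    (hℓ.continuous_right hx).continuousOn (a := 0)
    fun y hy => hpos y (by rintro rfl; simp at hy)
  obtain ⟨R, hR, hRD, h⟩ := hℓ.exists_abs_sub_le hx (half_pos hc)
  refine ⟨R, hR, c / 2, half_pos hc, hRD, fun z hz y => ?_⟩
  have h1 := (abs_le.1 (h z hz y)).1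
  have h2 := hℓ.mul_norm_le_of_sphere hx hcx y
  linarith

theorem integrableOn (hℓ : IsLocalAction D ℓ) {φ φ' : ℝ → Euc n} {a b : ℝ}
    (hφ : ContinuousOn φ (Icc a b)) (hφD : ∀ t ∈ Icc a b, φ t ∈ D)
    (hφ' : IntegrableOn φ' (Icc a b)) : IntegrableOn (fun t => ℓ (φ t) (φ' t)) (Icc a b) := by
  obtain ⟨C, -, hC⟩ := hℓ.exists_le_mul_norm (isCompact_Icc.image_of_continuousOn hφ)
    (image_subset_iff.2 hφD)
  have hmeas : Measurable ((D ×ˢ univ).indicator fun p : Euc n × Euc n => ℓ p.1 p.2) := by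
    classical
    rw [← piecewise_eq_indicator]
    exact hℓ.continuousOn.measurable_piecewise continuousOn_const
      (hℓ.isOpen.measurableSet.prod MeasurableSet.univ)
  refine (hφ'.norm.const_mul C).mono' ?_ ?_
  · have hpair : AEMeasurable (fun t => (φ t, φ' t)) (volume.restrict (Icc a b)) :=
      (hφ.aemeasurable measurableSet_Icc).prodMk hφ'.aestronglyMeasurable.aemeasurable
    refine (hmeas.comp_aemeasurable hpair).aestronglyMeasurable.congr ?_
    filter_upwards [ae_restrict_mem measurableSet_Icc] with t ht
    exact indicator_of_mem (s := D ×ˢ univ) (a := (φ t, φ' t)) ⟨hφD t ht, trivial⟩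
      fun p : Euc n × Euc n => ℓ p.1 p.2
  · filter_upwards [ae_restrict_mem measurableSet_Icc] with t ht
    rw [Real.norm_of_nonneg (hℓ.nonneg _ (hφD t ht) _)]
    exact hC _ (mem_image_of_mem φ ht) _

/-- Jensen's inequality for a local action with frozen base point. -/
theorem map_integral_le (hℓ : IsLocalAction D ℓ) {z : Euc n} (hz : z ∈ D) {g : ℝ → Euc n}
    {a b : ℝ} (hab : a ≤ b) (hg : IntegrableOn g (Icc a b)) :
    ℓ z (∫ t in a..b, g t) ≤ ∫ t in a..b, ℓ z (g t) := by
  rcases hab.eq_or_lt with rfl | hab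
  · simp [hℓ.map_zero hz]
  have hint := hℓ.integrableOn (φ := fun _ => z) continuousOn_const (fun _ _ => hz) hg
  have h := (hℓ.convexOn z hz).map_set_average_le (μ := volume) (t := Ioc a b) (f := g)
    (hℓ.continuous_right hz).continuousOn isClosed_univ (by simp [hab]) (by simp) (by simp)
    (hg.mono_set Ioc_subset_Icc_self) (hint.mono_set Ioc_subset_Icc_self)
  have hpos : 0 ≤ (b - a)⁻¹ := inv_nonneg.2 (sub_nonneg.2 hab.le)
  rw [setAverage_eq, setAverage_eq, Real.volume_real_Ioc_of_le hab.le, hℓ.hom z hz _ _ hpos,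
    smul_eq_mul] at h
  rw [intervalIntegral.integral_of_le hab.le, intervalIntegral.integral_of_le hab.le]
  exact le_of_mul_le_mul_left h (inv_pos.2 (sub_pos.2 hab))

end IsLocalAction

theorem LipschitzWith.of_dist_le_mul_sub {X : Type*} [PseudoMetricSpace X] {C : NNReal}
    {f : ℝ → X} (h : ∀ s t, s ≤ t → dist (f s) (f t) ≤ C * (t - s)) : LipschitzWith C f := by
  refine LipschitzWith.of_dist_le_mul fun s t => ?_
  rcases le_total s t with hst | hst
  · rw [dist_comm s t, Real.dist_eq, abs_of_nonneg (sub_nonneg.2 hst)]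
    exact h s t hst
  · rw [dist_comm, Real.dist_eq, abs_of_nonneg (sub_nonneg.2 hst)]
    exact h t s hst

section Curves

variable {n : ℕ} {D : Set (Euc n)} {ℓ : Euc n → Euc n → ℝ}

/-- A change of parameter after which a curve of length less than `M` is `M`-Lipschitz. -/
theorem exists_reparam {φ' : ℝ → Euc n} (h : IntegrableOn φ' (Icc 0 1)) {M : ℝ}
    (hM : geoLen φ' < M) : ∃ σ : ℝ → ℝ, (∀ t, σ t ∈ Icc (0 : ℝ) 1) ∧ (∀ t ≤ 0, σ t = 0) ∧
      (∀ t, 1 ≤ t → σ t = 1) ∧ Monotone σ ∧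
      ∀ s t, s ≤ t → ∫ u in σ s..σ t, ‖φ' u‖ ≤ M * (t - s) := by
  have h0 : (0 : ℝ) ∈ Icc (0 : ℝ) 1 := ⟨le_rfl, zero_le_one⟩
  have h1 : (1 : ℝ) ∈ Icc (0 : ℝ) 1 := ⟨zero_le_one, le_rfl⟩
  set ε := M - geoLen φ' with hε
  have hε0 : 0 < ε := sub_pos.2 hM
  have hlen : 0 ≤ geoLen φ' :=
    intervalIntegral.integral_nonneg zero_le_one fun _ _ => norm_nonneg _
  let Λ : ℝ → ℝ := fun u => (∫ s in (0 : ℝ)..u, ‖φ' s‖) + ε * u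
  have hΛ : ∀ u ∈ Icc (0 : ℝ) 1, ∀ v ∈ Icc (0 : ℝ) 1,
      Λ v - Λ u = (∫ s in u..v, ‖φ' s‖) + ε * (v - u) := by
    intro u hu v hv
    rw [← intervalIntegral.integral_interval_sub_left
      (IntegrableOn.intervalIntegrable_of_mem_Icc h.norm h0 hv)
      (IntegrableOn.intervalIntegrable_of_mem_Icc h.norm h0 hu)]
    simp only [Λ]
    ring
  have hΛ0 : Λ 0 = 0 := by simp [Λ]
  have hΛ1 : Λ 1 = M := by
    simp only [Λ, hε, geoLen]
    ring
  have hΛc : ContinuousOn Λ (Icc 0 1) := by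
    have := intervalIntegral.continuousOn_primitive_interval (a := (0 : ℝ)) (b := 1)
      (f := fun s => ‖φ' s‖) (μ := volume) (by rw [uIcc_of_le zero_le_one]; exact h.norm)
    rw [uIcc_of_le zero_le_one] at this
    exact this.add (by fun_prop)
  have hΛlt : ∀ u ∈ Icc (0 : ℝ) 1, ∀ v ∈ Icc (0 : ℝ) 1, u < v → Λ u < Λ v := by
    intro u hu v hv huv
    have h2 : 0 ≤ ∫ s in u..v, ‖φ' s‖ :=
      intervalIntegral.integral_nonneg huv.le fun _ _ => norm_nonneg _
    have h3 := hΛ u hu v hv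
    have h4 := mul_pos hε0 (sub_pos.2 huv)
    linarith
  have hM0 : 0 < M := hlen.trans_lt hM
  let p : ℝ → ℝ := fun t => max 0 (min t 1)
  have hsurj : ∀ t, ∃ u ∈ Icc (0 : ℝ) 1, Λ u = M * p t := by
    intro t
    refine intermediate_value_Icc zero_le_one hΛc ?_
    rw [hΛ0, hΛ1]
    exact ⟨by positivity, mul_le_of_le_one_right hM0.le (by simp [p])⟩
  choose σ hσ hσΛ using hsurj
  have hinj : ∀ u ∈ Icc (0 : ℝ) 1, ∀ v ∈ Icc (0 : ℝ) 1, Λ u = Λ v → u = v := by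
    intro u hu v hv huv
    rcases lt_trichotomy u v with hlt | heq | hlt
    · exact absurd huv (hΛlt u hu v hv hlt).ne
    · exact heq
    · exact absurd huv (hΛlt v hv u hu hlt).ne'
  have hp : ∀ s t, s ≤ t → p s ≤ p t ∧ p t - p s ≤ t - s := by
    intro s t hst
    simp only [p]
    grind
  have hmono : Monotone σ := by
    intro s t hst
    by_contra! hlt
    have h2 := hΛlt _ (hσ t) _ (hσ s) hlt
    rw [hσΛ, hσΛ] at h2
    exact absurd (mul_le_mul_of_nonneg_left (hp s t hst).1 hM0.le) h2.not_ge
  refine ⟨σ, hσ, fun t ht => hinj _ (hσ t) _ h0 ?_, fun t ht => hinj _ (hσ t) _ h1 ?_, hmono,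
    fun s t hst => ?_⟩
  · rw [hσΛ, hΛ0, show p t = 0 by simp only [p]; grind, mul_zero]
  · rw [hσΛ, hΛ1, show p t = 1 by simp only [p]; grind, mul_one]
  · have h2 := hΛ _ (hσ s) _ (hσ t)
    rw [hσΛ, hσΛ] at h2
    have h3 := mul_nonneg hε0.le (sub_nonneg.2 (hmono hst))
    have h4 := mul_le_mul_of_nonneg_left (hp s t hst).2 hM0.le
    linarith

namespace IsLocalAction

/-- Curves whose action is too small cannot leave a ball on which `ℓ` is coercive. -/
theorem mem_closedBall_of_action_lt (hℓ : IsLocalAction D ℓ) {x : Euc n} {r R c : ℝ}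
    (hball : ∀ z ∈ Metric.closedBall x R, ∀ y, c * ‖y‖ ≤ ℓ z y) (hc : 0 < c)
    {φ φ' : ℝ → Euc n} (h : GeoAC φ φ') (hφD : ∀ t ∈ Icc (0 : ℝ) 1, φ t ∈ D)
    (h0 : φ 0 ∈ Metric.closedBall x r) (hact : geoAction ℓ φ φ' < c * (R - r)) :
    ∀ t ∈ Icc (0 : ℝ) 1, φ t ∈ Metric.closedBall x R := by
  intro t ht
  by_contra hout
  have hcont : ContinuousOn (fun t => dist (φ t) x) (Icc 0 1) :=
    continuous_dist.comp_continuousOn (h.continuousOn.prodMk continuousOn_const)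
  have hcomp : IsCompact (Icc (0 : ℝ) 1 ∩ (fun t => dist (φ t) x) ⁻¹' Ici R) :=
    isCompact_Icc.of_isClosed_subset
      (hcont.preimage_isClosed_of_isClosed isClosed_Icc isClosed_Ici) inter_subset_left
  obtain ⟨τ, ⟨hτ, hτR⟩, hmin⟩ := hcomp.exists_isLeast
    ⟨t, ht, (not_le.1 (Metric.mem_closedBall.not.1 hout)).le⟩
  have h01 : (0 : ℝ) ∈ Icc (0 : ℝ) 1 := ⟨le_rfl, zero_le_one⟩
  have h11 : (1 : ℝ) ∈ Icc (0 : ℝ) 1 := ⟨zero_le_one, le_rfl⟩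
  have hint := hℓ.integrableOn h.continuousOn hφD h.1
  have hin : ∀ u ∈ Ioo 0 τ, φ u ∈ Metric.closedBall x R := by
    intro u hu
    by_contra hu'
    exact hu.2.not_ge (hmin ⟨⟨hu.1.le, hu.2.le.trans hτ.2⟩,
      (not_le.1 (Metric.mem_closedBall.not.1 hu')).le⟩)
  have h1 : c * ∫ u in (0 : ℝ)..τ, ‖φ' u‖ ≤ ∫ u in (0 : ℝ)..τ, ℓ (φ u) (φ' u) := by
    rw [← intervalIntegral.integral_const_mul]
    exact intervalIntegral.integral_mono_on_of_le_Ioo hτ.1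
      ((IntegrableOn.intervalIntegrable_of_mem_Icc h.1 h01 hτ).norm.const_mul c)
      (IntegrableOn.intervalIntegrable_of_mem_Icc hint h01 hτ) fun u hu => hball _ (hin u hu) _
  have h2 : ∫ u in (0 : ℝ)..τ, ℓ (φ u) (φ' u) ≤ geoAction ℓ φ φ' := by
    have h3 := intervalIntegral.integral_add_adjacent_intervals
      (IntegrableOn.intervalIntegrable_of_mem_Icc hint h01 hτ)
      (IntegrableOn.intervalIntegrable_of_mem_Icc hint hτ h11)
    have h4 : 0 ≤ ∫ u in τ..1, ℓ (φ u) (φ' u) := intervalIntegral.integral_nonneg hτ.2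
      fun u hu => hℓ.nonneg _ (hφD u ⟨hτ.1.trans hu.1, hu.2⟩) _
    rw [geoAction]
    linarith
  have h3 : R - r ≤ ∫ u in (0 : ℝ)..τ, ‖φ' u‖ := by
    refine le_trans ?_ (h.norm_sub_le h01 hτ hτ.1)
    rw [← dist_eq_norm]
    have h4 := dist_triangle (φ τ) (φ 0) x
    have h5 : R ≤ dist (φ τ) x := hτR
    have h6 : dist (φ 0) x ≤ r := h0
    linarith
  have h4 := mul_le_mul_of_nonneg_left h3 hc.le
  linarith

theorem mul_geoLen_le_geoAction (hℓ : IsLocalAction D ℓ) {c : ℝ} {φ φ' : ℝ → Euc n}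
    (h : GeoAC φ φ') (hφD : ∀ t ∈ Icc (0 : ℝ) 1, φ t ∈ D)
    (hc : ∀ t ∈ Icc (0 : ℝ) 1, ∀ y, c * ‖y‖ ≤ ℓ (φ t) y) :
    c * geoLen φ' ≤ geoAction ℓ φ φ' := by
  have h01 : (0 : ℝ) ∈ Icc (0 : ℝ) 1 := ⟨le_rfl, zero_le_one⟩
  have h11 : (1 : ℝ) ∈ Icc (0 : ℝ) 1 := ⟨zero_le_one, le_rfl⟩
  rw [geoLen, geoAction, ← intervalIntegral.integral_const_mul]
  exact intervalIntegral.integral_mono_on zero_le_one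
    ((IntegrableOn.intervalIntegrable_of_mem_Icc h.1 h01 h11).norm.const_mul c)
    (IntegrableOn.intervalIntegrable_of_mem_Icc
      (hℓ.integrableOn h.continuousOn hφD h.1) h01 h11) fun t ht => hc t ht _

theorem integral_le_mul_integral_norm (hℓ : IsLocalAction D ℓ) {C a b : ℝ}
    {φ φ' : ℝ → Euc n} (h : GeoAC φ φ') (hφD : ∀ t ∈ Icc (0 : ℝ) 1, φ t ∈ D)
    (hC : ∀ t ∈ Icc (0 : ℝ) 1, ∀ y, ℓ (φ t) y ≤ C * ‖y‖) (ha : a ∈ Icc (0 : ℝ) 1)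
    (hb : b ∈ Icc (0 : ℝ) 1) (hab : a ≤ b) :
    ∫ t in a..b, ℓ (φ t) (φ' t) ≤ C * ∫ t in a..b, ‖φ' t‖ := by
  rw [← intervalIntegral.integral_const_mul]
  exact intervalIntegral.integral_mono_on hab
    (IntegrableOn.intervalIntegrable_of_mem_Icc
      (hℓ.integrableOn h.continuousOn hφD h.1) ha hb)
    ((IntegrableOn.intervalIntegrable_of_mem_Icc h.1 ha hb).norm.const_mul C)
    fun t ht => hC t ⟨ha.1.trans ht.1, ht.2.trans hb.2⟩ _

theorem map_sub_le_integral_add (hℓ : IsLocalAction D ℓ) {φ φ' : ℝ → Euc n}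
    (h : GeoAC φ φ') (hφD : ∀ t ∈ Icc (0 : ℝ) 1, φ t ∈ D) {z : Euc n} (hz : z ∈ D)
    {a b ε : ℝ} (ha : a ∈ Icc (0 : ℝ) 1) (hb : b ∈ Icc (0 : ℝ) 1) (hab : a ≤ b)
    (hnear : ∀ u ∈ Icc a b, ∀ y, |ℓ (φ u) y - ℓ z y| ≤ ε * ‖y‖) :
    ℓ z (φ b - φ a) ≤ (∫ t in a..b, ℓ (φ t) (φ' t)) + ε * ∫ t in a..b, ‖φ' t‖ := by
  have h1 := IntegrableOn.intervalIntegrable_of_mem_Icc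
    (hℓ.integrableOn h.continuousOn hφD h.1) ha hb
  have h2 := (IntegrableOn.intervalIntegrable_of_mem_Icc h.1 ha hb).norm.const_mul ε
  have hint := h.1.mono_set (Icc_subset_Icc ha.1 hb.2)
  have h3 := IntegrableOn.intervalIntegrable_of_mem_Icc
    (hℓ.integrableOn (φ := fun _ => z) continuousOn_const (fun _ _ => hz) hint)
    (left_mem_Icc.2 hab) (right_mem_Icc.2 hab)
  rw [h.sub_eq_integral ha hb, ← intervalIntegral.integral_const_mul,
    ← intervalIntegral.integral_add h1 h2]
  refine (hℓ.map_integral_le hz hab hint).trans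
    (intervalIntegral.integral_mono_on hab h3 (h1.add h2) fun u hu => ?_)
  have h4 := (abs_le.1 (hnear u hu (φ' u))).1
  linarith

end IsLocalAction

end Curves

section Minimizers

variable {n : ℕ} {D Eset : Set (Euc n)} {ℓ : Euc n → Euc n → ℝ}

theorem GeoAC.lipschitzWith_comp {φ φ' : ℝ → Euc n} (h : GeoAC φ φ') {σ : ℝ → ℝ} {M : NNReal}
    (hσ : ∀ t, σ t ∈ Icc (0 : ℝ) 1) (hmono : Monotone σ)
    (hint : ∀ s t, s ≤ t → ∫ u in σ s..σ t, ‖φ' u‖ ≤ M * (t - s)) :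
    LipschitzWith M fun t => φ (σ t) := by
  refine LipschitzWith.of_dist_le_mul_sub fun s t hst => ?_
  rw [dist_comm, dist_eq_norm]
  exact (h.norm_sub_le (hσ s) (hσ t) (hmono hst)).trans (hint s t hst)

theorem GeoAssumpE.exists_lipschitzWith (hE : GeoAssumpE Eset) {x : Euc n} (hx : x ∈ Eset)
    {M : NNReal} (hM : 0 < M) : ∃ r > 0, ∀ w ∈ Metric.closedBall x r ∩ Eset,
      ∃ ψ : ℝ → Euc n, LipschitzWith M ψ ∧ (∀ t, ψ t ∈ Eset) ∧ (∀ t ≤ 0, ψ t = x) ∧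
        ∀ t, 1 ≤ t → ψ t = w := by
  have hM' : (0 : ℝ) < M := hM
  obtain ⟨r, hr, h⟩ := hE x hx (M / 2) (half_pos hM')
  refine ⟨r, hr, fun w hw => ?_⟩
  obtain ⟨φ, φ', hφ, hφE, h0, h1, hlen⟩ := h w hw
  obtain ⟨σ, hσ, hσ0, hσ1, hmono, hint⟩ :=
    exists_reparam hφ.1 (hlen.trans_lt (half_lt_self hM'))
  exact ⟨fun t => φ (σ t), hφ.lipschitzWith_comp hσ hmono hint, fun t => hφE _ (hσ t),
    fun t ht => by simp only [hσ0 t ht, h0],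
    fun t ht => by simp only [hσ1 t ht, h1]⟩

/-- Nearby points are joined by Lipschitz curves in `Eset` with a small Lipschitz constant,
which therefore stay near `x`. -/
theorem GeoAssumpE.exists_lipschitzWith_joining (hE : GeoAssumpE Eset) {x : Euc n}
    (hx : x ∈ Eset) {M : NNReal} (hM : 0 < M) :
    ∃ r > 0, ∀ x₁ ∈ Metric.closedBall x r ∩ Eset, ∀ x₂ ∈ Metric.closedBall x r ∩ Eset,
      ∃ f : ℝ → Euc n, LipschitzWith M f ∧
        (∀ t ∈ Icc (0 : ℝ) 1, f t ∈ Metric.closedBall x M ∩ Eset) ∧ f 0 = x₁ ∧ f 1 = x₂ := by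
  obtain ⟨r, hr, h⟩ := hE.exists_lipschitzWith hx (M := M / 4) (by positivity)
  refine ⟨r, hr, fun x₁ hx₁ x₂ hx₂ => ?_⟩
  obtain ⟨ψ₁, hl₁, hE₁, h0₁, h1₁⟩ := h x₁ hx₁
  obtain ⟨ψ₂, hl₂, hE₂, h0₂, h1₂⟩ := h x₂ hx₂
  have hf : LipschitzWith M fun t : ℝ => ψ₁ (1 - 2 * t) + ψ₂ (2 * t - 1) - x := by
    refine LipschitzWith.of_dist_le_mul fun s t => ?_
    have h1 := hl₁.dist_le_mul (1 - 2 * s) (1 - 2 * t)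
    have h2 := hl₂.dist_le_mul (2 * s - 1) (2 * t - 1)
    rw [show dist (1 - 2 * s) (1 - 2 * t) = 2 * dist s t by
      rw [Real.dist_eq, Real.dist_eq, show 1 - 2 * s - (1 - 2 * t) = -(2 * (s - t)) by ring,
        abs_neg, abs_mul, abs_two]] at h1
    rw [show dist (2 * s - 1) (2 * t - 1) = 2 * dist s t by
      rw [Real.dist_eq, Real.dist_eq, show 2 * s - 1 - (2 * t - 1) = 2 * (s - t) by ring,
        abs_mul, abs_two]] at h2
    push_cast at h1 h2
    rw [dist_sub_right]
    have h3 := dist_add_add_le (ψ₁ (1 - 2 * s)) (ψ₂ (2 * s - 1)) (ψ₁ (1 - 2 * t))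
      (ψ₂ (2 * t - 1))
    linarith
  have hhalf : ψ₁ (1 - 2 * (1 / 2)) + ψ₂ (2 * (1 / 2) - 1) - x = x := by
    rw [h0₁ _ (by norm_num), h0₂ _ (by norm_num)]
    abel
  refine ⟨_, hf, fun t ht => ⟨?_, ?_⟩, ?_, ?_⟩
  · have h1 := hf.dist_le_mul t (1 / 2)
    rw [hhalf] at h1
    refine h1.trans (mul_le_of_le_one_right M.2 ?_)
    rw [Real.dist_eq, abs_le]
    constructor <;> linarith [ht.1, ht.2]
  · rcases le_total t (1 / 2) with h1 | h1
    · simpa [h0₂ (2 * t - 1) (by linarith)] using hE₁ _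
    · simpa [h0₁ (1 - 2 * t) (by linarith)] using hE₂ _
  · simp [h1₁ 1 le_rfl, h0₂ (-1) (by norm_num)]
  · norm_num [h1₂ 1 le_rfl, h0₁ (-1) (by norm_num)]

theorem le_of_hasDerivAt_of_forall_le {g : Euc n → ℝ} (hg : Continuous g)
    (hhom : ∀ y, ∀ c : ℝ, 0 ≤ c → g (c • y) = c * g y) {f : ℝ → Euc n} {A : ℝ → ℝ} {s ε δ : ℝ}
    {f' : Euc n} {A' : ℝ} (hf : HasDerivAt f f' s) (hA : HasDerivAt A A' s) (hδ : 0 < δ)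
    (h : ∀ t, s ≤ t → t ≤ s + δ → g (f t - f s) ≤ A t - A s + ε * (t - s)) :
    g f' ≤ A' + ε := by
  have h1 := (hg.tendsto f').comp hf.tendsto_slope_zero_right
  have h2 := hA.tendsto_slope_zero_right.add_const ε
  refine le_of_tendsto_of_tendsto h1 h2 ?_
  filter_upwards [Ioo_mem_nhdsGT hδ] with t ht
  have h3 := h (s + t) (by linarith [ht.1]) (by linarith [ht.2])
  have h4 := mul_le_mul_of_nonneg_left h3 (inv_nonneg.2 ht.1.le)
  have h5 : t⁻¹ * t = 1 := inv_mul_cancel₀ ht.1.ne'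
  simp only [Function.comp_apply, smul_eq_mul]
  rw [hhom _ _ (inv_nonneg.2 ht.1.le)]
  calc _ ≤ _ := h4
    _ = t⁻¹ * (A (s + t) - A s) + (t⁻¹ * t) * ε := by ring
    _ = _ := by rw [h5, one_mul]

/-- Compactness and lower semicontinuity: a sequence of curves of bounded length in a compact
set has, after reparametrization, a limit curve whose action is at most the limit of the
actions. -/
theorem IsLocalAction.exists_lipschitzWith_action_le (hℓ : IsLocalAction D ℓ)
    {K : Set (Euc n)} (hK : IsCompact K) (hKD : K ⊆ D) {x₁ x₂ : Euc n} {M : NNReal} {m : ℝ}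
    {φ φ' : ℕ → ℝ → Euc n} (hφ : ∀ k, GeoAC (φ k) (φ' k))
    (hφK : ∀ k, ∀ t ∈ Icc (0 : ℝ) 1, φ k t ∈ K) (h0 : ∀ k, φ k 0 = x₁) (h1 : ∀ k, φ k 1 = x₂)
    (hlen : ∀ k, geoLen (φ' k) < M)
    (hm : Tendsto (fun k => geoAction ℓ (φ k) (φ' k)) atTop (nhds m)) :
    ∃ f : ℝ → Euc n, LipschitzWith M f ∧ (∀ t, f t ∈ K) ∧ f 0 = x₁ ∧ f 1 = x₂ ∧
      geoAction ℓ f (deriv f) ≤ m := by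
  obtain ⟨C, hC0, hC⟩ := hℓ.exists_le_mul_norm hK hKD
  have hφD : ∀ k, ∀ t ∈ Icc (0 : ℝ) 1, φ k t ∈ D := fun k t ht => hKD (hφK k t ht)
  choose σ hσ hσ0 hσ1 hmono hσint using fun k => exists_reparam (hφ k).1 (hlen k)
  have h00 : (0 : ℝ) ∈ Icc (0 : ℝ) 1 := ⟨le_rfl, zero_le_one⟩
  have h11 : (1 : ℝ) ∈ Icc (0 : ℝ) 1 := ⟨zero_le_one, le_rfl⟩
  let ψ : ℕ → ℝ → Euc n := fun k t => φ k (σ k t)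
  let a : ℕ → ℝ → ℝ := fun k t => ∫ u in (0 : ℝ)..σ k t, ℓ (φ k u) (φ' k u)
  have hψ : ∀ k, LipschitzWith M (ψ k) := fun k =>
    (hφ k).lipschitzWith_comp (hσ k) (hmono k) (hσint k)
  have ha_sub : ∀ k s t, a k t - a k s = ∫ u in σ k s..σ k t, ℓ (φ k u) (φ' k u) :=
    fun k s t => intervalIntegral.integral_interval_sub_left
      (IntegrableOn.intervalIntegrable_of_mem_Icc
        (hℓ.integrableOn (hφ k).continuousOn (hφD k) (hφ k).1) h00 (hσ k t))
      (IntegrableOn.intervalIntegrable_of_mem_Icc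
        (hℓ.integrableOn (hφ k).continuousOn (hφD k) (hφ k).1) h00 (hσ k s))
  have ha_mono : ∀ k s t, s ≤ t → a k s ≤ a k t := fun k s t hst => by
    rw [← sub_nonneg, ha_sub]
    exact intervalIntegral.integral_nonneg (hmono k hst) fun u hu =>
      hℓ.nonneg _ (hφD k u ⟨(hσ k s).1.trans hu.1, hu.2.trans (hσ k t).2⟩) _
  have ha : ∀ k, LipschitzWith (C.toNNReal * M) (a k) := fun k => by
    refine LipschitzWith.of_dist_le_mul_sub fun s t hst => ?_
    rw [dist_comm, Real.dist_eq, abs_of_nonneg (sub_nonneg.2 (ha_mono k s t hst)), ha_sub]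
    refine (hℓ.integral_le_mul_integral_norm (hφ k) (hφD k) (fun t ht => hC _ (hφK k t ht))
      (hσ k s) (hσ k t) (hmono k hst)).trans ?_
    rw [NNReal.coe_mul, Real.coe_toNNReal _ hC0.le, mul_assoc]
    exact mul_le_mul_of_nonneg_left (hσint k s t hst) hC0.le
  have ha0 : ∀ k, ∀ t ≤ 0, a k t = 0 := fun k t ht => by simp [a, hσ0 k t ht]
  have ha1 : ∀ k t, 1 ≤ t → a k t = geoAction ℓ (φ k) (φ' k) := fun k t ht => by
    simp [a, hσ1 k t ht, geoAction]
  have hψlim : ∀ t, ∃ y ∈ K, Tendsto (fun k => ψ k t) (hyperfilter ℕ) (nhds y) := fun t =>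
    hK.ultrafilter_le_nhds' ((hyperfilter ℕ).map fun k => ψ k t)
      (Ultrafilter.mem_map.2 (Eventually.of_forall fun k => hφK k _ (hσ k t)))
  have halim : ∀ t, ∃ y, Tendsto (fun k => a k t) (hyperfilter ℕ) (nhds y) := fun t => by
    obtain ⟨y, -, hy⟩ :=
      (isCompact_closedBall (0 : ℝ) ((C.toNNReal * M : NNReal) * dist t 0)).ultrafilter_le_nhds'
        ((hyperfilter ℕ).map fun k => a k t) (Ultrafilter.mem_map.2
          (Eventually.of_forall fun k => by
            have := (ha k).dist_le_mul t 0
            rwa [ha0 k 0 le_rfl] at this))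
    exact ⟨y, hy⟩
  choose f hfK hf using hψlim
  choose A hA using halim
  have hflip : LipschitzWith M f := LipschitzWith.of_dist_le_mul fun s t =>
    le_of_tendsto ((hf s).dist (hf t)) (Eventually.of_forall fun k => (hψ k).dist_le_mul s t)
  have hAlip : LipschitzWith (C.toNNReal * M) A := LipschitzWith.of_dist_le_mul fun s t =>
    le_of_tendsto ((hA s).dist (hA t)) (Eventually.of_forall fun k => (ha k).dist_le_mul s t)
  have hlocal : ∀ s, ∀ ε > 0, ∃ δ > 0, ∀ t, s ≤ t → t ≤ s + δ →
      ℓ (f s) (f t - f s) ≤ A t - A s + ε * M * (t - s) := by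
    intro s ε hε
    have hsD := hKD (hfK s)
    obtain ⟨δ, hδ, -, hnear⟩ := hℓ.exists_abs_sub_le hsD hε
    have hM0 : (0 : ℝ) < M + 1 := by positivity
    refine ⟨δ / 2 / (M + 1), by positivity, fun t hst ht => ?_⟩
    refine le_of_tendsto_of_tendsto
      (((hℓ.continuous_right hsD).tendsto _).comp ((hf t).sub (hf s)))
      (((hA t).sub (hA s)).add_const (ε * M * (t - s))) ?_
    filter_upwards [Metric.tendsto_nhds.1 (hf s) (δ / 2) (half_pos hδ)] with k hk
    have hMt : M * (t - s) ≤ δ / 2 := by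
      have h2 : (M + 1) * (t - s) ≤ δ / 2 := by
        rw [mul_comm, ← le_div_iff₀ hM0]
        linarith
      have h3 := sub_nonneg.2 hst
      linarith
    have hlow := hℓ.map_sub_le_integral_add (hφ k) (hφD k) hsD (hσ k s) (hσ k t)
      (hmono k hst) (ε := ε) fun u hu => hnear _ (by
        have hu01 : u ∈ Icc (0 : ℝ) 1 := ⟨(hσ k s).1.trans hu.1, hu.2.trans (hσ k t).2⟩
        have h2 := (hφ k).norm_sub_le (hσ k s) hu01 hu.1
        have h3 : ∫ v in σ k s..u, ‖φ' k v‖ ≤ ∫ v in σ k s..σ k t, ‖φ' k v‖ :=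
          intervalIntegral.integral_mono_interval le_rfl hu.1 hu.2
            (Eventually.of_forall fun _ => norm_nonneg _)
            (IntegrableOn.intervalIntegrable_of_mem_Icc (hφ k).1.norm (hσ k s) (hσ k t))
        have h4 := hσint k s t hst
        have h5 := dist_triangle (φ k u) (φ k (σ k s)) (f s)
        rw [dist_eq_norm (φ k u) (φ k (σ k s))] at h5
        have h6 : dist (φ k (σ k s)) (f s) < δ / 2 := hk
        rw [Metric.mem_closedBall]
        linarith)
    rw [← ha_sub] at hlow
    have h2 := mul_le_mul_of_nonneg_left (hσint k s t hst) hε.le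
    simp only [Function.comp_apply]
    change ℓ (f s) (φ k (σ k t) - φ k (σ k s)) ≤ _
    linarith
  have hderiv : ∀ᵐ s, ℓ (f s) (deriv f s) ≤ deriv A s := by
    filter_upwards [hflip.ae_differentiableAt_real, hAlip.ae_differentiableAt_real] with s hs1 hs2
    have hsD := hKD (hfK s)
    refine le_of_forall_pos_le_add fun ε hε => ?_
    obtain ⟨δ, hδ, h⟩ := hlocal s (ε / (M + 1)) (by positivity)
    refine (le_of_hasDerivAt_of_forall_le (hℓ.continuous_right hsD) (hℓ.hom _ hsD)
      hs1.hasDerivAt hs2.hasDerivAt hδ h).trans ?_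
    have hM0 : (0 : ℝ) < M + 1 := by positivity
    have h2 : ε / (M + 1) * M ≤ ε := by
      rw [div_mul_eq_mul_div, div_le_iff₀ hM0]
      linarith
    linarith
  have hne : (hyperfilter ℕ : Filter ℕ) ≤ atTop := Nat.hyperfilter_le_atTop
  have hf0 : f 0 = x₁ := tendsto_nhds_unique (hf 0)
    (tendsto_const_nhds.congr fun k => by simp [ψ, hσ0 k 0 le_rfl, h0])
  have hf1 : f 1 = x₂ := tendsto_nhds_unique (hf 1)
    (tendsto_const_nhds.congr fun k => by simp [ψ, hσ1 k 1 le_rfl, h1])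
  have hA0 : A 0 = 0 := tendsto_nhds_unique (hA 0)
    (tendsto_const_nhds.congr fun k => (ha0 k 0 le_rfl).symm)
  have hA1 : A 1 = m := tendsto_nhds_unique (hA 1)
    ((hm.mono_left hne).congr fun k => (ha1 k 1 le_rfl).symm)
  refine ⟨f, hflip, hfK, hf0, hf1, ?_⟩
  have hfint := hℓ.integrableOn hflip.continuous.continuousOn (fun t _ => hKD (hfK t))
    hflip.geoAC.1
  have h2 := intervalIntegral.integral_mono_ae zero_le_one
    (IntegrableOn.intervalIntegrable_of_mem_Icc hfint h00 h11)
    (hAlip.intervalIntegrable_deriv 0 1) hderiv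
  rwa [hAlip.integral_deriv_eq_sub, hA0, hA1, sub_zero] at h2

end Minimizers

/-- if `ℓ(x,y) > 0` for all `y ≠ 0`, then `x` has strong local
minimizers. -/
theorem statement8 {n : ℕ} (D : Set (Euc n)) (hD : IsOpen D) (hDne : D.Nonempty)
    (Eset : Set (Euc n)) (hEsub : Eset ⊆ D)
    (hEclosed : ∀ w ∈ D, w ∈ closure Eset → w ∈ Eset)
    (hAssumpE : GeoAssumpE Eset)
    (ℓ : Euc n → Euc n → ℝ)
    (hℓcont : ContinuousOn (fun p : Euc n × Euc n => ℓ p.1 p.2) (D ×ˢ Set.univ))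
    (hℓnonneg : ∀ x ∈ D, ∀ y : Euc n, 0 ≤ ℓ x y)
    (hℓhom : ∀ x ∈ D, ∀ y : Euc n, ∀ c : ℝ, 0 ≤ c → ℓ x (c • y) = c * ℓ x y)
    (hℓconv : ∀ x ∈ D, ConvexOn ℝ Set.univ (fun y => ℓ x y))
    (x : Euc n) (hx : x ∈ Eset)
    (hpos : ∀ y : Euc n, y ≠ 0 → 0 < ℓ x y) :
    GeoHasStrongLocalMin ℓ Eset x := by
  have hℓ : IsLocalAction D ℓ := ⟨hD, hℓcont, hℓnonneg, hℓhom, hℓconv⟩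
  obtain ⟨R, hR, c, hc, hRD, hcoer⟩ := hℓ.exists_mul_norm_le (hEsub hx) hpos
  set K := Metric.closedBall x R ∩ Eset
  have hKD : K ⊆ D := fun z hz => hEsub hz.2
  have hK : IsCompact K := by
    have h : K = Metric.closedBall x R ∩ closure Eset :=
      Subset.antisymm (inter_subset_inter_right _ subset_closure)
        fun z hz => ⟨hz.1, hEclosed z (hRD hz.1) hz.2⟩
    rw [h]
    exact (isCompact_closedBall x R).inter_right isClosed_closure
  obtain ⟨C, hC0, hC⟩ := hℓ.exists_le_mul_norm hK hKD
  have hM : 0 < min R (c * R / (4 * C)) := by positivity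
  obtain ⟨r, hr, hjoin⟩ := hAssumpE.exists_lipschitzWith_joining hx
    (M := ⟨min R (c * R / (4 * C)), hM.le⟩) hM
  refine ⟨min r (R / 2), by positivity, R, hR, K, hK, inter_subset_right,
    fun x₁ hx₁ x₂ hx₂ => ?_⟩
  have hbdd : BddBelow (geoActSet ℓ Eset {x₁} {x₂}) := by
    refine ⟨0, ?_⟩
    rintro s ⟨φ, φ', -, hφE, -, -, rfl⟩
    exact intervalIntegral.integral_nonneg zero_le_one fun t ht => hℓ.nonneg _ (hEsub (hφE t ht)) _
  have hsub : Metric.closedBall x (min r (R / 2)) ⊆ Metric.closedBall x r :=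
    Metric.closedBall_subset_closedBall (min_le_left _ _)
  obtain ⟨f, hf, hfE, hf0, hf1⟩ := hjoin x₁ ⟨hsub hx₁.1, hx₁.2⟩ x₂ ⟨hsub hx₂.1, hx₂.2⟩
  have hfK : ∀ t ∈ Icc (0 : ℝ) 1, f t ∈ K := fun t ht =>
    ⟨Metric.closedBall_subset_closedBall (min_le_left _ _) (hfE t ht).1, (hfE t ht).2⟩
  have hmem : geoAction ℓ f (deriv f) ∈ geoActSet ℓ Eset {x₁} {x₂} :=
    ⟨f, deriv f, hf.geoAC, fun t ht => (hfE t ht).2, hf0, hf1, rfl⟩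
  have hfact : geoAction ℓ f (deriv f) < c * (R - R / 2) := by
    have h1 := hℓ.integral_le_mul_integral_norm hf.geoAC (fun t ht => hKD (hfK t ht))
      (fun t ht => hC _ (hfK t ht)) ⟨le_rfl, zero_le_one⟩ ⟨zero_le_one, le_rfl⟩ zero_le_one
    have h2 : geoLen (deriv f) ≤ c * R / (4 * C) := hf.geoLen_deriv_le.trans (min_le_right _ _)
    have h3 := mul_le_mul_of_nonneg_left h2 hC0.le
    have h4 : C * (c * R / (4 * C)) = c * R / 4 := by field_simp
    have h5 : geoAction ℓ f (deriv f) ≤ C * geoLen (deriv f) := h1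
    have h6 : 0 < c * R := by positivity
    linarith
  set m := sInf (geoActSet ℓ Eset {x₁} {x₂})
  have hmlt : m < c * (R - R / 2) := (csInf_le hbdd hmem).trans_lt hfact
  have hseq : ∀ k : ℕ, ∃ φ φ' : ℝ → Euc n, GeoAC φ φ' ∧ (∀ t ∈ Icc (0 : ℝ) 1, φ t ∈ Eset) ∧
      φ 0 = x₁ ∧ φ 1 = x₂ ∧ geoAction ℓ φ φ' < c * (R - R / 2) ∧
      geoAction ℓ φ φ' < m + 1 / ((k : ℝ) + 1) := by
    intro k
    have hk : m < min (c * (R - R / 2)) (m + 1 / ((k : ℝ) + 1)) :=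
      lt_min hmlt (lt_add_of_pos_right _ (by positivity))
    obtain ⟨s, ⟨φ, φ', hφ, hφE, h0, h1, rfl⟩, hs⟩ := exists_lt_of_csInf_lt ⟨_, hmem⟩ hk
    exact ⟨φ, φ', hφ, hφE, h0, h1, hs.trans_le (min_le_left _ _), hs.trans_le (min_le_right _ _)⟩
  choose φ φ' hφ hφE h0 h1 hact hlim using hseq
  have hφD : ∀ k, ∀ t ∈ Icc (0 : ℝ) 1, φ k t ∈ D := fun k t ht => hEsub (hφE k t ht)
  have hφball : ∀ k, ∀ t ∈ Icc (0 : ℝ) 1, φ k t ∈ Metric.closedBall x R := fun k =>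
    hℓ.mem_closedBall_of_action_lt hcoer hc (hφ k) (hφD k)
      (by rw [h0]; exact Metric.closedBall_subset_closedBall (min_le_right _ _) hx₁.1) (hact k)
  have hlen : ∀ k, geoLen (φ' k) < (⟨R, hR.le⟩ : NNReal) := fun k => by
    have h2 := hℓ.mul_geoLen_le_geoAction (hφ k) (hφD k) fun t ht => hcoer _ (hφball k t ht)
    have h3 : c * geoLen (φ' k) < c * (R - R / 2) := h2.trans_lt (hact k)
    have h4 : geoLen (φ' k) < R - R / 2 := lt_of_mul_lt_mul_left h3 hc.le
    change geoLen (φ' k) < R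
    linarith
  have hmem_k : ∀ k, geoAction ℓ (φ k) (φ' k) ∈ geoActSet ℓ Eset {x₁} {x₂} := fun k =>
    ⟨φ k, φ' k, hφ k, hφE k, h0 k, h1 k, rfl⟩
  have htends : Tendsto (fun k => geoAction ℓ (φ k) (φ' k)) atTop (nhds m) := by
    refine tendsto_of_tendsto_of_tendsto_of_le_of_le tendsto_const_nhds ?_
      (fun k => csInf_le hbdd (hmem_k k)) fun k => (hlim k).le
    simpa using tendsto_const_nhds.add (tendsto_one_div_add_atTop_nhds_zero_nat (𝕜 := ℝ))
  obtain ⟨g, hg, hgK, hg0, hg1, hgact⟩ := hℓ.exists_lipschitzWith_action_le hK hKD hφ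
    (fun k t ht => ⟨hφball k t ht, hφE k t ht⟩) h0 h1 hlen htends
  exact ⟨g, deriv g, hg.geoAC, fun t _ => hgK t, hg0, hg1, hg.geoLen_deriv_le,
    hgact.antisymm (csInf_le hbdd
      ⟨g, deriv g, hg.geoAC, fun t _ => (hgK t).2, hg0, hg1, rfl⟩)⟩
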